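/- For t ≥ a−1 and d smaller than the number of monomials in R_t, one has d_{n,t} ≥ d^{<n−2>}; moreover, for 0 ≤ h < a−1 (with d smaller than the number of monomials in R_h), d_{n,h} > d^{<n−2>}. -/

import Mathlib

open scoped Classical
open Finset

noncomputable section

/-- The monomials of degree `t` in `n` variables, identified with exponent vectors. -/
def degMon (n t : ℕ) : Finset (Fin n → ℕ) := Finset.Nat.antidiagonalTuple n t

/-- The exponent of `x_1` in a monomial. -/
def x1exp {n : ℕ} (m : Fin n → ℕ) : ℕ := if h : 0 < n then m ⟨0, h⟩ else 0

/-- `lexLt u v` : `u` is lexicographically smaller than `v` as monomials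
(with `x_1 > x_2 > ... > x_n`), i.e. `v > u`. -/
def lexLt {n : ℕ} (u v : Fin n → ℕ) : Prop :=
  ∃ i : Fin n, (∀ j : Fin n, j < i → u j = v j) ∧ u i < v i

/-- `M` is a lexsegment set inside the ground set `G` of monomials. -/
def IsLexSeg {n : ℕ} (G M : Finset (Fin n → ℕ)) : Prop :=
  M ⊆ G ∧ ∀ m ∈ M, ∀ v ∈ G, lexLt m v → v ∈ M

/-- The lexsegment set consisting of the top `d` monomials of `G` in the lex order. -/
def lexSeg {n : ℕ} (G : Finset (Fin n → ℕ)) (d : ℕ) : Finset (Fin n → ℕ) :=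
  G.filter (fun m => (G.filter (fun v => m = v ∨ lexLt m v)).card ≤ d)

/-- `S_1 · M` : all monomials `u * m` with `u` a variable and `m ∈ M`. -/
def S1mul (n : ℕ) (M : Finset (Fin n → ℕ)) : Finset (Fin n → ℕ) :=
  Finset.univ.biUnion (fun i : Fin n => M.image (fun m => m + Pi.single i 1))

/-- `S'_1 · M` : all monomials `x_i * m` with `2 ≤ i ≤ n` and `m ∈ M`. -/
def S1'mul (n : ℕ) (M : Finset (Fin n → ℕ)) : Finset (Fin n → ℕ) :=
  (Finset.univ.filter (fun i : Fin n => (i : ℕ) ≠ 0)).biUnion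
    (fun i => M.image (fun m => m + Pi.single i 1))

/-- `d^{<k>}` : the number of monomials obtained by multiplying each member of the
lexsegment set of `d` monomials of a fixed degree in `k+1` variables by each of the
`k+1` variables.  (We realize it in degree `d`, where the lexsegment set exists;
the number is independent of the chosen degree.  Also `0^{<k>} = 0`.) -/
def growth (d k : ℕ) : ℕ := (S1mul (k + 1) (lexSeg (degMon (k + 1) d) d)).card

/-- The monomials of `R_t` where `R = S/(x_1^a)` : degree-`t` monomials whose
`x_1`-exponent is at most `a - 1`. -/
def RMon (n a t : ℕ) : Finset (Fin n → ℕ) :=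
  (degMon n t).filter (fun m => x1exp m < a)

/-- `R_1 · M` : the monomials of `S_1 · M` not divisible by `x_1^a`. -/
def R1mul (n a : ℕ) (M : Finset (Fin n → ℕ)) : Finset (Fin n → ℕ) :=
  (S1mul n M).filter (fun m => x1exp m < a)

/-- `d_{n,t}` : the size of `R_1 · L` for the lexsegment set `L` of `d` monomials in `R_t`. -/
def dnt (n a t d : ℕ) : ℕ := (R1mul n a (lexSeg (RMon n a t) d)).card

/-- `M^i` : the monomials of `M` divisible by `x_1^i` but not by `x_1^{i+1}`. -/
def comp {n : ℕ} (M : Finset (Fin n → ℕ)) (i : ℕ) : Finset (Fin n → ℕ) :=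
  M.filter (fun m => x1exp m = i)

/-- `I(M)` : the smallest `i` such that `M^i ≠ ∅`. -/
def Imon {n : ℕ} (M : Finset (Fin n → ℕ)) : ℕ := sInf {i | (comp M i).Nonempty}

/-- `M` is Gotzmann in `S_t`. -/
def GotzmannS (n t : ℕ) (M : Finset (Fin n → ℕ)) : Prop :=
  (S1mul n (lexSeg (degMon n t) M.card)).card = (S1mul n M).card

/-- `M` is Gotzmann in `R_t`, `R = S/(x_1^a)`. -/
def GotzmannR (n a t : ℕ) (M : Finset (Fin n → ℕ)) : Prop :=
  (R1mul n a (lexSeg (RMon n a t) M.card)).card = (R1mul n a M).card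

/-- The monomials of degree `t` of `S' = F[x_2,...,x_n]`, viewed inside the `n`
variables as the monomials with `x_1`-exponent `0`. -/
def SpMon (n t : ℕ) : Finset (Fin n → ℕ) :=
  (degMon n t).filter (fun m => x1exp m = 0)

/-- `M` is Gotzmann in `S' = F[x_2,...,x_n]` (in degree `t`). -/
def GotzmannSp (n t : ℕ) (M : Finset (Fin n → ℕ)) : Prop :=
  (S1'mul n (lexSeg (SpMon n t) M.card)).card = (S1'mul n M).card

/-- Dividing a monomial by the pure power of `x_1` it contains: set the first exponent to `0`. -/
def clearX1 {n : ℕ} (m : Fin n → ℕ) : Fin n → ℕ :=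
  fun j => if (j : ℕ) = 0 then 0 else m j

/-- `M^i / x_1` : the monomials `m` of `S'` with `m * x_1^i ∈ M^i` (applied to `M = M^i`). -/
def divX1 {n : ℕ} (M : Finset (Fin n → ℕ)) : Finset (Fin n → ℕ) :=
  M.image clearX1

/-- `u · M` : the monomials `u * m` with `m ∈ M`. -/
def mulMon {n : ℕ} (u : Fin n → ℕ) (M : Finset (Fin n → ℕ)) : Finset (Fin n → ℕ) :=
  M.image (fun m => u + m)

/-- The set `B` of degree-`t` monomials of `S` divisible by `x_1^a`. -/
def Bset (n a t : ℕ) : Finset (Fin n → ℕ) :=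
  (degMon n t).filter (fun m => a ≤ x1exp m)
/-! ### Arithmetic part -/

def Sn (N : ℕ → ℕ) (m : ℕ) : ℕ := ∑ i ∈ Finset.range m, N i

def Ff (g N : ℕ → ℕ) (d : ℕ) : ℕ := ∑ i ∈ Finset.range (d + 1), g (min (N i) (d - Sn N i))

structure Good (g N : ℕ → ℕ) : Prop where
  zero : g 0 = 0
  mono : Monotone g
  pos : ∀ i, 0 < N i
  monoN : Monotone N
  sub : ∀ x y, g (x + y) ≤ g x + g y
  fill : ∀ e x y, x ≤ N e → y ≤ N e → N e ≤ x + y → g (N e) + g (x + y - N e) ≤ g x + g y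

theorem Sn_succ (N : ℕ → ℕ) (m : ℕ) : Sn N (m + 1) = Sn N m + N m := by
  simp [Sn, Finset.sum_range_succ]

theorem Sn_mono (N : ℕ → ℕ) : Monotone (Sn N) :=
  monotone_nat_of_le_succ (fun m => by rw [Sn_succ]; omega)

theorem le_Sn {N : ℕ → ℕ} (h : ∀ i, 0 < N i) (m : ℕ) : m ≤ Sn N m := by
  induction m with
  | zero => simp
  | succ m ih => rw [Sn_succ]; have := h m; omega

theorem sum_blocks {g N : ℕ → ℕ} (h : Good g N) (d E : ℕ) (hE : d ≤ Sn N E) :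
    ∑ i ∈ Finset.range E, g (min (N i) (d - Sn N i)) = Ff g N d := by
  have key : ∀ E1 E2, d ≤ Sn N E1 → E1 ≤ E2 →
      ∑ i ∈ Finset.range E1, g (min (N i) (d - Sn N i)) =
      ∑ i ∈ Finset.range E2, g (min (N i) (d - Sn N i)) := by
    intro E1 E2 h1 h12
    apply Finset.sum_subset
    · intro i hi
      simp only [Finset.mem_range] at *
      omega
    · intro i _ hi
      simp only [Finset.mem_range, not_lt] at hi
      have := Sn_mono N hi
      have h0 : d - Sn N i = 0 := by omega
      simp [h0, h.zero]
  unfold Ff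
  have hd : d ≤ Sn N (d + 1) := by have := le_Sn h.pos (d + 1); omega
  rw [key E (max E (d + 1)) hE (le_max_left _ _), key (d + 1) (max E (d + 1)) hd (le_max_right _ _)]

theorem Ff_spec {g N : ℕ → ℕ} (h : Good g N) (m r : ℕ) (hr : r ≤ N m) :
    Ff g N (Sn N m + r) = ∑ i ∈ Finset.range m, g (N i) + g r := by
  rw [← sum_blocks h _ (m + 1) (by rw [Sn_succ]; omega), Finset.sum_range_succ]
  congr 1
  · apply Finset.sum_congr rfl
    intro i hi
    simp only [Finset.mem_range] at hi
    have := Sn_mono N (show i + 1 ≤ m by omega)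
    rw [Sn_succ] at this
    congr 1
    omega
  · congr 1
    omega

theorem exists_lt_rep {N : ℕ → ℕ} (h : ∀ i, 0 < N i) (c : ℕ) :
    ∃ m r, c = Sn N m + r ∧ r < N m := by
  induction c with
  | zero => exact ⟨0, 0, by simp [Sn], h 0⟩
  | succ c ih =>
    obtain ⟨m, r, hc, hr⟩ := ih
    by_cases h1 : r + 1 < N m
    · exact ⟨m, r + 1, by omega, h1⟩
    · exact ⟨m + 1, 0, by rw [Sn_succ]; omega, h _⟩

theorem exists_pos_rep {N : ℕ → ℕ} (h : ∀ i, 0 < N i) (c : ℕ) (hc : 0 < c) :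
    ∃ m r, c = Sn N m + r ∧ 0 < r ∧ r ≤ N m := by
  obtain ⟨m, r, h1, h2⟩ := exists_lt_rep h (c - 1)
  exact ⟨m, r + 1, by omega, by omega, by omega⟩

theorem Ff_zero {g N : ℕ → ℕ} (h : Good g N) : Ff g N 0 = 0 := by
  simp [Ff, h.zero]

theorem move {g N : ℕ → ℕ} (h : Good g N) (c d : ℕ) (hd : 0 < d) (hcd : d ≤ c) :
    ∃ δ, 0 < δ ∧ δ ≤ d ∧ Ff g N (c + δ) + Ff g N (d - δ) ≤ Ff g N c + Ff g N d ∧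
      ∀ e, c < Sn N e → c + δ ≤ Sn N e := by
  obtain ⟨m, r, hc, hr⟩ := exists_lt_rep h.pos c
  obtain ⟨l, s, hd', hs0, hs⟩ := exists_pos_rep h.pos d hd
  have hlm : l ≤ m := by
    by_contra hlt
    have := Sn_mono N (show m + 1 ≤ l by omega)
    rw [Sn_succ] at this
    omega
  have hN := h.monoN hlm
  have hb : ∀ e, c < Sn N e → Sn N m + N m ≤ Sn N e := by
    intro e he
    have : m + 1 ≤ e := by
      by_contra hlt
      have := Sn_mono N (show e ≤ m by omega)
      omega
    have := Sn_mono N this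
    rwa [Sn_succ] at this
  have e1 := Ff_spec h m r hr.le
  have e2 := Ff_spec h l s hs
  rw [← hc] at e1
  rw [← hd'] at e2
  by_cases hrs : r + s ≤ N m
  · refine ⟨s, hs0, by omega, ?_, ?_⟩
    · have e3 := Ff_spec h m (r + s) hrs
      have e4 := Ff_spec h l 0 (Nat.zero_le _)
      rw [show c + s = Sn N m + (r + s) by omega, show d - s = Sn N l + 0 by omega, e1, e2, e3, e4,
        h.zero]
      have := h.sub r s
      omega
    · intro e he
      have := hb e he
      omega
  · refine ⟨N m - r, by omega, by omega, ?_, ?_⟩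
    · have e3 := Ff_spec h m (N m) le_rfl
      have e4 := Ff_spec h l (r + s - N m) (by omega)
      rw [show c + (N m - r) = Sn N m + N m by omega,
        show d - (N m - r) = Sn N l + (r + s - N m) by omega, e1, e2, e3, e4]
      have := h.fill m r s hr.le (by omega) (by omega)
      omega
    · intro e he
      have := hb e he
      omega

theorem Ff_sub_aux {g N : ℕ → ℕ} (h : Good g N) (d : ℕ) :
    ∀ c, d ≤ c → Ff g N (c + d) ≤ Ff g N c + Ff g N d := by
  induction d using Nat.strong_induction_on with
  | _ d ih =>
    intro c hcd
    rcases Nat.eq_zero_or_pos d with h0 | h0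
    · subst h0; simp
    · obtain ⟨δ, h1, h2, h3, _⟩ := move h c d h0 hcd
      have := ih (d - δ) (by omega) (c + δ) (by omega)
      rw [show c + δ + (d - δ) = c + d by omega] at this
      omega

theorem Ff_sub {g N : ℕ → ℕ} (h : Good g N) (x y : ℕ) :
    Ff g N (x + y) ≤ Ff g N x + Ff g N y := by
  rcases le_total y x with h1 | h1
  · exact Ff_sub_aux h y x h1
  · have := Ff_sub_aux h x y h1
    rw [add_comm x y]
    omega

theorem Ff_fill_aux {g N : ℕ → ℕ} (h : Good g N) (e y : ℕ) :
    ∀ x, y ≤ x → x ≤ Sn N e → Sn N e ≤ x + y →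
      Ff g N (Sn N e) + Ff g N (x + y - Sn N e) ≤ Ff g N x + Ff g N y := by
  induction y using Nat.strong_induction_on with
  | _ y ih =>
    intro x hyx hx hxy
    rcases Nat.lt_or_ge x (Sn N e) with h0 | h0
    · obtain ⟨δ, h1, h2, h3, h4⟩ := move h x y (by omega) hyx
      have := ih (y - δ) (by omega) (x + δ) (by omega) (h4 e h0) (by omega)
      rw [show x + δ + (y - δ) = x + y by omega] at this
      omega
    · have : x = Sn N e := by omega
      subst this
      simp

theorem Ff_fill {g N : ℕ → ℕ} (h : Good g N) (e x y : ℕ) (hx : x ≤ Sn N e) (hy : y ≤ Sn N e)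
    (hxy : Sn N e ≤ x + y) :
    Ff g N (Sn N e) + Ff g N (x + y - Sn N e) ≤ Ff g N x + Ff g N y := by
  rcases le_total y x with h1 | h1
  · exact Ff_fill_aux h e y x h1 hx hxy
  · have := Ff_fill_aux h e x y h1 hy (by omega)
    rw [add_comm x y]
    omega

def Nk : ℕ → ℕ → ℕ
  | 0 => fun _ => 1
  | (k + 1) => fun e => Sn (Nk k) (e + 1)

def Gk : ℕ → ℕ → ℕ
  | 0 => fun d => min d 1
  | (k + 1) => fun d => min d 1 + Ff (Gk k) (Nk k) d

theorem Ff_mono {g N : ℕ → ℕ} (h : Good g N) : Monotone (Ff g N) := by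
  intro c d hcd
  have hd : d ≤ Sn N (d + 1) := by have := le_Sn h.pos (d + 1); omega
  rw [← sum_blocks h d (d + 1) hd, ← sum_blocks h c (d + 1) (by omega)]
  apply Finset.sum_le_sum
  intro i _
  apply h.mono
  omega

theorem good_k (k : ℕ) : Good (Gk k) (Nk k) := by
  induction k with
  | zero =>
    refine ⟨by simp [Gk], ?_, by simp [Nk], ?_, ?_, ?_⟩
    · intro x y h; simp only [Gk]; omega
    · intro x y h; simp [Nk]
    · intro x y; simp only [Gk]; omega
    · intro e x y; simp only [Gk, Nk]; omega
  | succ k ih =>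
    refine ⟨by simp [Gk, Ff_zero ih], ?_, ?_, ?_, ?_, ?_⟩
    · intro x y h
      have := Ff_mono ih h
      simp only [Gk]; omega
    · intro i
      have := le_Sn ih.pos (i + 1)
      simp only [Nk]; omega
    · intro x y h
      exact Sn_mono _ (by omega)
    · intro x y
      have := Ff_sub ih x y
      simp only [Gk]; omega
    · intro e x y hx hy hxy
      have := Ff_fill ih (e + 1) x y hx hy hxy
      have h3 := le_Sn ih.pos (e + 1)
      simp only [Gk, Nk] at *
      omega

theorem blocks_eq {N a : ℕ → ℕ} {E : ℕ} (hN : ∀ i, 0 < N i) (ha : ∀ i < E, a i ≤ N i)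
    (hfull : ∀ i < E, 0 < a i → ∀ j < i, a j = N j) (i : ℕ) (hi : i < E) :
    a i = min (N i) (∑ j ∈ Finset.range E, a j - Sn N i) := by
  obtain ⟨q, rfl⟩ : ∃ q, E = i + 1 + q := ⟨E - (i + 1), by omega⟩
  rw [Finset.sum_range_add, Finset.sum_range_succ]
  have hle : ∑ j ∈ Finset.range i, a j ≤ Sn N i :=
    Finset.sum_le_sum (fun j hj => ha j (by simp only [Finset.mem_range] at hj; omega))
  have hz : a i < N i → ∑ x ∈ Finset.range q, a (i + 1 + x) = 0 := by
    intro hlt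
    apply Finset.sum_eq_zero
    intro x hx
    simp only [Finset.mem_range] at hx
    by_contra hne
    have := hfull (i + 1 + x) (by omega) (by omega) i (by omega)
    omega
  have hai := ha i hi
  rcases Nat.eq_zero_or_pos (a i) with h0 | h0
  · have := hz (by have := hN i; omega)
    omega
  · have hs : ∑ j ∈ Finset.range i, a j = Sn N i :=
      Finset.sum_congr rfl (fun j hj => hfull i hi h0 j (by simpa using hj))
    by_cases hlt : a i < N i
    · have := hz hlt
      omega
    · omega

/-! ### Monomial part -/

def xslice {k : ℕ} (j : ℕ) (M : Finset (Fin (k + 1) → ℕ)) : Finset (Fin k → ℕ) :=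
  (M.filter (fun m => m 0 = j)).image Fin.tail

theorem mem_xslice {k : ℕ} {j : ℕ} {M : Finset (Fin (k + 1) → ℕ)} {u : Fin k → ℕ} :
    u ∈ xslice j M ↔ (Fin.cons j u : Fin (k + 1) → ℕ) ∈ M := by
  simp only [xslice, Finset.mem_image, Finset.mem_filter]
  constructor
  · rintro ⟨m, ⟨hm, rfl⟩, rfl⟩
    rwa [Fin.cons_self_tail]
  · intro h
    exact ⟨_, ⟨h, by simp⟩, by simp⟩

theorem card_slices {k : ℕ} (M : Finset (Fin (k + 1) → ℕ)) (E : ℕ) (h : ∀ m ∈ M, m 0 < E) :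
    M.card = ∑ j ∈ Finset.range E, (xslice j M).card := by
  rw [Finset.card_eq_sum_card_fiberwise (f := fun m => m 0) (t := Finset.range E)
    (fun m hm => by simpa using h m hm)]
  apply Finset.sum_congr rfl
  intro j _
  rw [xslice, Finset.card_image_of_injOn]
  intro m hm m' hm' he
  simp only [Finset.coe_filter, Set.mem_setOf_eq] at hm hm'
  rw [← Fin.cons_self_tail m, ← Fin.cons_self_tail m', he, hm.2, hm'.2]

theorem sum_slices_le {k : ℕ} (M : Finset (Fin (k + 1) → ℕ)) (E : ℕ) :
    ∑ j ∈ Finset.range E, (xslice j M).card ≤ M.card := by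
  have h := card_slices (M.filter (fun m => m 0 < E)) E (fun m hm => (Finset.mem_filter.1 hm).2)
  have : ∑ j ∈ Finset.range E, (xslice j M).card =
      ∑ j ∈ Finset.range E, (xslice j (M.filter (fun m => m 0 < E))).card := by
    apply Finset.sum_congr rfl
    intro j hj
    congr 1
    ext u
    simp only [Finset.mem_range] at hj
    simp [mem_xslice, hj]
  rw [this, ← h]
  exact Finset.card_filter_le _ _

theorem mem_degMon {n t : ℕ} {m : Fin n → ℕ} : m ∈ degMon n t ↔ ∑ i, m i = t := by
  simp [degMon, Finset.Nat.mem_antidiagonalTuple]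

theorem cons_mem_degMon {k e j : ℕ} {u : Fin k → ℕ} :
    (Fin.cons j u : Fin (k + 1) → ℕ) ∈ degMon (k + 1) e ↔ j ≤ e ∧ u ∈ degMon k (e - j) := by
  simp only [mem_degMon, Fin.sum_univ_succ, Fin.cons_zero, Fin.cons_succ]
  omega

theorem slice_degMon {k e j : ℕ} (hj : j ≤ e) :
    xslice j (degMon (k + 1) e) = degMon k (e - j) := by
  ext u
  simp [mem_xslice, cons_mem_degMon, hj]

theorem head_le {k e : ℕ} {m : Fin (k + 1) → ℕ} (h : m ∈ degMon (k + 1) e) : m 0 ≤ e := by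
  rw [← Fin.cons_self_tail m, cons_mem_degMon] at h
  exact h.1

theorem degMon_one (e : ℕ) : degMon 1 e = {fun _ => e} := by
  ext m
  simp only [mem_degMon, Finset.mem_singleton, Fin.sum_univ_one]
  constructor
  · intro h; ext i; rw [Subsingleton.elim i 0]; exact h
  · rintro rfl; rfl

theorem card_degMon (k : ℕ) : ∀ e, (degMon (k + 1) e).card = Nk k e := by
  induction k with
  | zero => intro e; simp [degMon_one, Nk]
  | succ k ih =>
    intro e
    rw [card_slices _ (e + 1) (fun m hm => Nat.lt_succ_of_le (head_le hm)),
      ← Finset.sum_range_reflect]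
    simp only [Nk, Sn]
    apply Finset.sum_congr rfl
    intro j hj
    simp only [Finset.mem_range] at hj
    rw [slice_degMon (by omega), ih]
    congr 1
    omega

theorem mem_S1mul {n : ℕ} {M : Finset (Fin n → ℕ)} {v : Fin n → ℕ} :
    v ∈ S1mul n M ↔ ∃ i, ∃ m ∈ M, m + Pi.single i 1 = v := by
  simp [S1mul]

theorem cons_add_single_zero {k j : ℕ} (u : Fin k → ℕ) :
    (Fin.cons j u : Fin (k + 1) → ℕ) + Pi.single 0 1 = Fin.cons (j + 1) u := by
  ext i
  refine Fin.cases ?_ (fun i => ?_) i <;> simp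

theorem cons_add_single_succ {k j : ℕ} (u : Fin k → ℕ) (i : Fin k) :
    (Fin.cons j u : Fin (k + 1) → ℕ) + Pi.single i.succ 1 = Fin.cons j (u + Pi.single i 1) := by
  ext l
  refine Fin.cases ?_ (fun l => ?_) l
  · simp
  · simp [Pi.single_apply]

theorem cons_mem_S1mul {k j : ℕ} {M : Finset (Fin (k + 1) → ℕ)} {u : Fin k → ℕ} :
    (Fin.cons j u : Fin (k + 1) → ℕ) ∈ S1mul (k + 1) M ↔
      (∃ j', j = j' + 1 ∧ u ∈ xslice j' M) ∨ u ∈ S1mul k (xslice j M) := by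
  simp only [mem_S1mul, mem_xslice]
  constructor
  · rintro ⟨i, m, hm, he⟩
    rw [← Fin.cons_self_tail m] at he hm
    revert he
    refine Fin.cases ?_ (fun i => ?_) i
    · intro he
      rw [cons_add_single_zero] at he
      obtain ⟨h1, h2⟩ := Fin.cons_inj.1 he
      subst h2
      exact Or.inl ⟨_, h1.symm, hm⟩
    · intro he
      rw [cons_add_single_succ] at he
      obtain ⟨h1, h2⟩ := Fin.cons_inj.1 he
      rw [h1] at hm
      exact Or.inr ⟨i, _, hm, h2⟩
  · rintro (⟨j', rfl, h⟩ | ⟨i, m, hm, rfl⟩)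
    · exact ⟨0, _, h, cons_add_single_zero _⟩
    · exact ⟨i.succ, _, hm, cons_add_single_succ _ _⟩

theorem lexLt_cons_same {k j : ℕ} {u v : Fin k → ℕ} (h : lexLt u v) :
    lexLt (Fin.cons j u : Fin (k + 1) → ℕ) (Fin.cons j v) := by
  obtain ⟨i, h1, h2⟩ := h
  refine ⟨i.succ, ?_, by simpa using h2⟩
  intro l
  refine Fin.cases ?_ (fun l => ?_) l
  · simp
  · intro hl
    simpa using h1 l (by simpa using hl)

theorem lexLt_cons_lt {k j j' : ℕ} {u v : Fin k → ℕ} (h : j < j') :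
    lexLt (Fin.cons j u : Fin (k + 1) → ℕ) (Fin.cons j' v) :=
  ⟨0, fun l hl => absurd hl (by simp), by simpa using h⟩

theorem slice_lexSeg {k j : ℕ} {G M : Finset (Fin (k + 1) → ℕ)} (h : IsLexSeg G M) :
    IsLexSeg (xslice j G) (xslice j M) := by
  constructor
  · intro u hu
    rw [mem_xslice] at *
    exact h.1 hu
  · intro m hm v hv hlt
    rw [mem_xslice] at *
    exact h.2 _ hm _ hv (lexLt_cons_same hlt)

theorem S1mul_degMon (k e : ℕ) : degMon (k + 1) (e + 1) ⊆ S1mul (k + 1) (degMon (k + 1) e) := by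
  intro v hv
  rw [mem_degMon] at hv
  obtain ⟨i, hi⟩ : ∃ i, v i ≠ 0 := by
    by_contra hne
    push Not at hne
    simp [hne] at hv
  have hs : v - Pi.single i 1 + Pi.single i 1 = v := by
    ext l
    by_cases hl : l = i
    · subst hl; simp; omega
    · simp [Pi.single_apply, hl]
  rw [mem_S1mul]
  refine ⟨i, v - Pi.single i 1, ?_, hs⟩
  rw [mem_degMon]
  have h2 : ∑ l, (v - Pi.single i 1 + Pi.single i 1 : Fin (k + 1) → ℕ) l = e + 1 := by rw [hs, hv]
  simp only [Pi.add_apply, Finset.sum_add_distrib] at h2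
  simp at h2
  simpa using h2

theorem S1mul_sub {n e : ℕ} {M : Finset (Fin n → ℕ)} (h : M ⊆ degMon n e) :
    S1mul n M ⊆ degMon n (e + 1) := by
  intro v hv
  obtain ⟨i, m, hm, rfl⟩ := mem_S1mul.1 hv
  have := mem_degMon.1 (h hm)
  rw [mem_degMon]
  simp [Finset.sum_add_distrib, this]

theorem card_S1mul (k : ℕ) : ∀ (e : ℕ) (L : Finset (Fin (k + 1) → ℕ)),
    IsLexSeg (degMon (k + 1) e) L → (S1mul (k + 1) L).card = Gk k L.card := by
  induction k with
  | zero =>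
    intro e L hL
    have h1 := hL.1
    rw [degMon_one, Finset.subset_singleton_iff] at h1
    rcases h1 with rfl | rfl
    · simp [S1mul, Gk]
    · simp [S1mul, Gk]
  | succ k ih =>
    intro e L hL
    have hgood := good_k k
    have hlex : ∀ j, j ≤ e → IsLexSeg (degMon (k + 1) (e - j)) (xslice j L) := by
      intro j hj
      have := slice_lexSeg (j := j) hL
      rwa [slice_degMon hj] at this
    have hfull : ∀ j j', j < j' → j' ≤ e → (xslice j L).Nonempty →
        xslice j' L = degMon (k + 1) (e - j') := by
      intro j j' hjj hj' ⟨u, hu⟩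
      apply Finset.Subset.antisymm (hlex j' hj').1
      intro v hv
      rw [mem_xslice] at *
      exact hL.2 _ hu _ (cons_mem_degMon.2 ⟨hj', hv⟩) (lexLt_cons_lt hjj)
    have hcard : L.card = ∑ i ∈ Finset.range (e + 1), (xslice (e - i) L).card := by
      rw [card_slices L (e + 1) (fun m hm => Nat.lt_succ_of_le (head_le (hL.1 hm))),
        ← Finset.sum_range_reflect]
      apply Finset.sum_congr rfl
      intro i _
      congr 2
    have hblock : ∀ i < e + 1, (xslice (e - i) L).card = min (Nk k i) (L.card - Sn (Nk k) i) := by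
      rw [hcard]
      refine blocks_eq (a := fun i => (xslice (e - i) L).card) hgood.pos ?_ ?_
      · intro i hi
        have := Finset.card_le_card (hlex (e - i) (by omega)).1
        rwa [card_degMon, show e - (e - i) = i by omega] at this
      · intro i hi h0 j hj
        rw [hfull (e - i) (e - j) (by omega) (by omega) (Finset.card_pos.1 h0), card_degMon,
          show e - (e - j) = j by omega]
    have hle : L.card ≤ Sn (Nk k) (e + 1) := by
      have := Finset.card_le_card hL.1
      rwa [card_degMon] at this
    have hS : ∀ j ≤ e, xslice j (S1mul (k + 2) L) = S1mul (k + 1) (xslice j L) := by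
      intro j hj
      ext u
      rw [mem_xslice, cons_mem_S1mul]
      constructor
      · rintro (⟨j', rfl, h⟩ | h)
        · rw [hfull j' (j' + 1) (by omega) hj ⟨u, h⟩]
          apply S1mul_degMon
          have := (hlex j' (by omega)).1 h
          rwa [show e - (j' + 1) + 1 = e - j' by omega]
        · exact h
      · exact Or.inr
    have hlast : (xslice (e + 1) (S1mul (k + 2) L)).card = min L.card 1 := by
      have h1 : xslice (e + 1) (S1mul (k + 2) L) = xslice e L := by
        ext u
        rw [mem_xslice, cons_mem_S1mul]
        constructor
        · rintro (⟨j', h1, h⟩ | h)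
          · obtain rfl : e = j' := by omega
            exact h
          · obtain ⟨i, m, hm, _⟩ := mem_S1mul.1 h
            rw [mem_xslice] at hm
            have := (cons_mem_degMon.1 (hL.1 hm)).1
            omega
        · intro h
          exact Or.inl ⟨e, rfl, h⟩
      rw [h1]
      have h2 := hblock 0 (by omega)
      have h3 : Nk k 0 = 1 := by
        rw [← card_degMon]
        simp [degMon, Finset.Nat.antidiagonalTuple_zero_right]
      rw [h3] at h2
      simp only [Sn, Finset.sum_range_zero, Nat.sub_zero] at h2
      omega
    rw [card_slices _ (e + 1 + 1) (fun m hm => Nat.lt_succ_of_le (head_le (S1mul_sub hL.1 hm))),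
      Finset.sum_range_succ, hlast, ← Finset.sum_range_reflect]
    simp only [Gk]
    rw [add_comm, ← sum_blocks hgood L.card (e + 1) hle]
    congr 1
    apply Finset.sum_congr rfl
    intro i hi
    simp only [Finset.mem_range] at hi
    rw [show e + 1 - 1 - i = e - i by omega, hS _ (by omega),
      ih (e - (e - i)) _ (hlex _ (by omega)), hblock i hi]

/-! ### The order -/

theorem lexLt_trichotomy {n : ℕ} (u v : Fin n → ℕ) : u = v ∨ lexLt u v ∨ lexLt v u := by
  rcases lt_trichotomy (toLex u) (toLex v) with h | h | h
  · right; left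
    obtain ⟨i, h1, h2⟩ := h
    exact ⟨i, h1, h2⟩
  · left; exact toLex.injective h
  · right; right
    obtain ⟨i, h1, h2⟩ := h
    exact ⟨i, h1, h2⟩

theorem lexLt_iff {n : ℕ} (u v : Fin n → ℕ) : lexLt u v ↔ toLex u < toLex v := Iff.rfl

theorem le_iff' {n : ℕ} (u v : Fin n → ℕ) : (u = v ∨ lexLt u v) ↔ toLex u ≤ toLex v := by
  rw [lexLt_iff, le_iff_eq_or_lt, toLex_inj]
  exact Iff.rfl

theorem lexSeg_isLexSeg {n : ℕ} (G : Finset (Fin n → ℕ)) (d : ℕ) : IsLexSeg G (lexSeg G d) := by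
  refine ⟨Finset.filter_subset _ _, ?_⟩
  intro m hm v hv hlt
  simp only [lexSeg, Finset.mem_filter, le_iff'] at *
  refine ⟨hv, le_trans (Finset.card_le_card ?_) hm.2⟩
  intro w hw
  simp only [Finset.mem_filter] at *
  exact ⟨hw.1, le_trans (le_of_lt hlt) hw.2⟩

theorem card_lexSeg_le {n : ℕ} (G : Finset (Fin n → ℕ)) (d : ℕ) : (lexSeg G d).card ≤ d := by
  rcases (lexSeg G d).eq_empty_or_nonempty with h | h
  · simp [h]
  · obtain ⟨m, hm, hmin⟩ := Finset.exists_min_image (lexSeg G d) toLex h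
    refine le_trans (Finset.card_le_card ?_) (Finset.mem_filter.1 hm).2
    intro v hv
    rw [Finset.mem_filter, le_iff']
    exact ⟨(Finset.mem_filter.1 hv).1, hmin v hv⟩

theorem le_card_lexSeg {n : ℕ} (G : Finset (Fin n → ℕ)) (d : ℕ) (hd : d ≤ G.card) :
    d ≤ (lexSeg G d).card := by
  by_contra hlt
  have hne : (G \ lexSeg G d).Nonempty := by
    rw [Finset.nonempty_iff_ne_empty]
    intro h0
    have := Finset.card_le_card (Finset.sdiff_eq_empty_iff_subset.1 h0)
    omega
  obtain ⟨m, hm, hmax⟩ := Finset.exists_max_image _ toLex hne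
  rw [Finset.mem_sdiff] at hm
  apply hm.2
  rw [lexSeg, Finset.mem_filter]
  refine ⟨hm.1, ?_⟩
  have : (G.filter (fun v => m = v ∨ lexLt m v)) ⊆ insert m (lexSeg G d) := by
    intro v hv
    rw [Finset.mem_filter, le_iff'] at hv
    rw [Finset.mem_insert]
    by_contra hcon
    push Not at hcon
    have h1 := hmax v (Finset.mem_sdiff.2 ⟨hv.1, hcon.2⟩)
    exact hcon.1 (toLex.injective (le_antisymm h1 hv.2))
  have h1 := Finset.card_le_card this
  have h2 := Finset.card_insert_le m (lexSeg G d)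
  omega

theorem x1exp_cons {k j : ℕ} (u : Fin k → ℕ) : x1exp (Fin.cons j u : Fin (k + 1) → ℕ) = j := by
  simp only [x1exp, Nat.succ_pos, dif_pos]
  rfl

theorem Gk_sum (k : ℕ) (a : ℕ → ℕ) (E : ℕ) :
    Gk k (∑ j ∈ Finset.range E, a j) ≤ ∑ j ∈ Finset.range E, Gk k (a j) := by
  induction E with
  | zero => simp [(good_k k).zero]
  | succ E ih =>
    rw [Finset.sum_range_succ, Finset.sum_range_succ]
    have := (good_k k).sub (∑ j ∈ Finset.range E, a j) (a E)
    omega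

theorem growth_le (d k : ℕ) : growth d k ≤ Gk k d := by
  rw [growth, card_S1mul k d _ (lexSeg_isLexSeg _ _)]
  exact (good_k k).mono (card_lexSeg_le _ _)

theorem slice_RMon {k a t j : ℕ} (hj : j ≤ t) (ha : j < a) :
    xslice j (RMon (k + 1) a t) = degMon k (t - j) := by
  ext u
  simp [mem_xslice, RMon, cons_mem_degMon, hj, x1exp_cons, ha]

theorem main_bound (k a t d : ℕ) (hd0 : 0 < d) (hd : d < (RMon (k + 2) a t).card) :
    growth d k + (if t + 1 < a then 1 else 0) ≤ dnt (k + 2) a t d := by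
  set L := lexSeg (RMon (k + 2) a t) d with hLdef
  have hL : IsLexSeg (RMon (k + 2) a t) L := lexSeg_isLexSeg _ _
  have hc1 : d ≤ L.card := le_card_lexSeg _ _ hd.le
  have hdeg : ∀ m ∈ L, m 0 ≤ t := fun m hm => head_le (Finset.mem_filter.1 (hL.1 hm)).1
  have hcard := card_slices L (t + 1) (fun m hm => Nat.lt_succ_of_le (hdeg m hm))
  have hslice : ∀ j < t + 1, Gk k (xslice j L).card ≤ (xslice j (R1mul (k + 2) a L)).card := by
    intro j hj
    by_cases hja : j < a
    · have hl := slice_lexSeg (j := j) hL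
      rw [slice_RMon (by omega) hja] at hl
      rw [← card_S1mul k _ _ hl]
      apply Finset.card_le_card
      intro u hu
      rw [mem_xslice, R1mul, Finset.mem_filter, x1exp_cons, cons_mem_S1mul]
      exact ⟨Or.inr hu, hja⟩
    · have : xslice j L = ∅ := by
        rw [Finset.eq_empty_iff_forall_notMem]
        intro u hu
        rw [mem_xslice] at hu
        have := (Finset.mem_filter.1 (hL.1 hu)).2
        rw [x1exp_cons] at this
        exact hja this
      simp [this, (good_k k).zero]
  have hlast : (if t + 1 < a then 1 else 0) ≤ (xslice (t + 1) (R1mul (k + 2) a L)).card := by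
    split_ifs with hta
    · rw [Nat.succ_le_iff, Finset.card_pos]
      refine ⟨0, ?_⟩
      rw [mem_xslice, R1mul, Finset.mem_filter, x1exp_cons, cons_mem_S1mul]
      refine ⟨Or.inl ⟨t, rfl, ?_⟩, hta⟩
      have h0 : (0 : Fin (k + 1) → ℕ) ∈ xslice t (RMon (k + 2) a t) := by
        rw [slice_RMon le_rfl (by omega), mem_degMon]
        simp
      rw [mem_xslice] at h0 ⊢
      obtain ⟨m, hm⟩ := Finset.card_pos.1 (lt_of_lt_of_le hd0 hc1)
      have hmd := (Finset.mem_filter.1 (hL.1 hm)).1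
      have hmt := hdeg m hm
      rw [← Fin.cons_self_tail m] at hm hmd
      rcases Nat.lt_or_ge (m 0) t with h1 | h1
      · exact hL.2 _ hm _ h0 (lexLt_cons_lt h1)
      · have h2 : m 0 = t := by omega
        rw [cons_mem_degMon, h2, mem_degMon] at hmd
        have h3 : Fin.tail m = 0 := by
          have := hmd.2
          rw [Nat.sub_self, Finset.sum_eq_zero_iff] at this
          ext i
          exact this i (Finset.mem_univ _)
        rwa [h2, h3] at hm
    · exact Nat.zero_le _
  have h1 := sum_slices_le (R1mul (k + 2) a L) (t + 1 + 1)
  rw [Finset.sum_range_succ] at h1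
  have h2 := Finset.sum_le_sum (fun j hj => hslice j (Finset.mem_range.1 hj))
  have h3 := Gk_sum k (fun j => (xslice j L).card) (t + 1)
  rw [← hcard] at h3
  have h4 := growth_le d k
  have h5 := (good_k k).mono hc1
  have h6 : dnt (k + 2) a t d = (R1mul (k + 2) a L).card := rfl
  omega

/-- For `t ≥ a - 1` one has `d_{n,t} ≥ d^{<n-2>}`; moreover, for
`0 ≤ h < a - 1` one has `d_{n,h} > d^{<n-2>}`. -/
theorem stmt_1 (n a d : ℕ) (hn : 2 ≤ n) (ha : 1 ≤ a) (hd0 : 0 < d) :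
    (∀ t : ℕ, a - 1 ≤ t → d < (RMon n a t).card →
      growth d (n - 2) ≤ dnt n a t d) ∧
    (∀ h : ℕ, h < a - 1 → d < (RMon n a h).card →
      growth d (n - 2) < dnt n a h d) := by
  obtain ⟨k, rfl⟩ : ∃ k, n = k + 2 := ⟨n - 2, by omega⟩
  rw [Nat.add_sub_cancel]
  constructor
  · intro t _ hd
    exact le_trans (Nat.le_add_right _ _) (main_bound k a t d hd0 hd)
  · intro h hh hd
    have := main_bound k a h d hd0 hd
    rw [if_pos (by omega)] at this
    omega
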